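/- arXiv:1704.08327 — 7 statements merged into one kernel-verified Lean document; each statement's English description precedes it below -/
import Mathlib

section
/- Let (n_i)_{i<ω} be a strictly increasing sequence of natural numbers and let b, c ⊆ ℕ. Suppose the set u = {i : [n_i, n_{i+1}) ∩ b = ∅} is infinite, and, letting (i(l))_{l<ω} be the strictly increasing enumeration of u, suppose the set v = {l : [n_{i(l)}, n_{i(l+1)}) ∩ c = ∅} is also infinite. Then the set {i : [n_i, n_{i+1}) ∩ (b ∪ c) = ∅} is infinite. -/
/-- Subclaim 1 in the proof of Observation 4: if infinitely many gaps
`[n i, n (i+1))` miss `b`, and along the enumeration `Nat.nth (· ∈ u)` of those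
gaps infinitely many of the coarser gaps miss `c`, then infinitely many gaps
miss `b ∪ c`. -/
theorem stmt_0 (n : ℕ → ℕ) (hn : StrictMono n) (b c : Set ℕ)
    (u : Set ℕ) (hu : u = {i | Set.Ico (n i) (n (i + 1)) ∩ b = ∅})
    (huinf : u.Infinite)
    (v : Set ℕ)
    (hv : v = {l | Set.Ico (n (Nat.nth (· ∈ u) l)) (n (Nat.nth (· ∈ u) (l + 1))) ∩ c = ∅})
    (hvinf : v.Infinite) :
    {i | Set.Ico (n i) (n (i + 1)) ∩ (b ∪ c) = ∅}.Infinite := by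
  have hmono : StrictMono (Nat.nth (· ∈ u)) := Nat.nth_strictMono huinf
  refine (hvinf.image hmono.injective.injOn).mono ?_
  rintro _ ⟨l, hl, rfl⟩
  have hb : Nat.nth (· ∈ u) l ∈ u := Nat.nth_mem_of_infinite huinf l
  generalize hi : Nat.nth (· ∈ u) l = i at hb
  rw [hu] at hb
  rw [hv, Set.mem_ofPred_eq, hi] at hl
  have hle : n (i + 1) ≤ n (Nat.nth (· ∈ u) (l + 1)) :=
    hn.monotone (hi ▸ hmono l.lt_succ_self)
  have hc : Set.Ico (n i) (n (i + 1)) ∩ c = ∅ :=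
    Set.subset_eq_empty (Set.inter_subset_inter_left c (Set.Ico_subset_Ico_right hle)) hl
  rw [Set.mem_ofPred_eq, Set.inter_union_distrib_left, hb, hc, Set.union_empty]
end

section
/- Let a ⊆ ℕ be infinite with strictly increasing enumeration e_a : ℕ → ℕ (so e_a(k) is the (k+1)-st smallest element of a), and let g : ℕ → ℕ. Define a sequence (n_i)_{i<ω} by n_0 = 0 and any choice of n_{i+1} with n_{i+1} > n_i + g(n_i). If the set {i : [n_i, n_{i+1}) ∩ a = ∅} is infinite, then the set {k : g(k) < e_a(k)} is infinite. -/
/-- One direction of Subclaim 2 in the proof of Observation 4: if the sequence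
`n` grows fast relative to `g` (namely `n 0 = 0` and `n (i+1) > n i + g (n i)`)
and infinitely many intervals `[n i, n (i+1))` are disjoint from the infinite
set `a`, then the increasing enumeration `Nat.nth (· ∈ a)` of `a` is not
dominated by `g`. -/
theorem stmt_1 (a : Set ℕ) (ha : a.Infinite) (g : ℕ → ℕ) (n : ℕ → ℕ)
    (hn0 : n 0 = 0) (hns : ∀ i, n (i + 1) > n i + g (n i))
    (hinf : {i | Set.Ico (n i) (n (i + 1)) ∩ a = ∅}.Infinite) :
    {k | g k < Nat.nth (· ∈ a) k}.Infinite := by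
  have hn : StrictMono n := strictMono_nat_of_lt_succ fun i => by have := hns i; omega
  refine (hinf.image hn.injective.injOn).mono ?_
  rintro _ ⟨i, hi, rfl⟩
  have hle : n i ≤ Nat.nth (· ∈ a) (n i) := (Nat.nth_strictMono ha).le_apply
  have hmem : Nat.nth (· ∈ a) (n i) ∈ a := Nat.nth_mem_of_infinite ha (n i)
  have hge : n (i + 1) ≤ Nat.nth (· ∈ a) (n i) := by
    by_contra! hlt
    exact Set.eq_empty_iff_forall_notMem.mp hi _ ⟨⟨hle, hlt⟩, hmem⟩
  have hgap := hns i
  change g (n i) < Nat.nth (· ∈ a) (n i)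
  omega
end

section
/- Let a ⊆ ℕ be infinite with strictly increasing enumeration e_a : ℕ → ℕ, let (n_i)_{i<ω} be a strictly increasing sequence of natural numbers, and let f : ℕ → ℕ be increasing such that for every l: (i) l < f(l), and (ii) there are more than l + 1 indices i ≥ l with [n_i, n_{i+1}) ⊆ [l, f(l)). If the set {l : f(l) ≤ e_a(l)} is infinite, then the set {i : [n_i, n_{i+1}) ∩ a = ∅} is infinite. -/
/-- The other direction of Subclaim 2 in the proof of Observation 4: if `f` is
increasing, `l < f l`, each interval `[l, f l)` contains more than `l + 1` of
the gaps `[n i, n (i+1))` with `i ≥ l`, and infinitely often `f l ≤` the `l`-th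
element of `a`, then infinitely many gaps `[n i, n (i+1))` are disjoint
from `a`. -/
theorem stmt_2 (a : Set ℕ) (ha : a.Infinite) (n : ℕ → ℕ) (hn : StrictMono n)
    (f : ℕ → ℕ) (hf : Monotone f) (hfl : ∀ l, l < f l)
    (hmany : ∀ l, ∃ s : Finset ℕ, l + 1 < s.card ∧
      ∀ i ∈ s, l ≤ i ∧ Set.Ico (n i) (n (i + 1)) ⊆ Set.Ico l (f l))
    (hinf : {l | f l ≤ Nat.nth (· ∈ a) l}.Infinite) :
    {i | Set.Ico (n i) (n (i + 1)) ∩ a = ∅}.Infinite := by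
  classical
  refine Set.infinite_of_forall_exists_gt fun N => ?_
  obtain ⟨l, hl, hNl⟩ := hinf.exists_gt N
  obtain ⟨s, hcard, hs⟩ := hmany l
  by_contra! hcon
  have hmeet : ∀ i ∈ s, ∃ x, x ∈ Set.Ico (n i) (n (i + 1)) ∩ a := by
    intro i hi
    by_contra! hx
    have hle := hcon i (Set.eq_empty_iff_forall_notMem.mpr hx)
    have := (hs i hi).1
    omega
  choose! g hg using hmeet
  have hcount : Nat.count (· ∈ a) (f l) ≤ l :=
    (Nat.count_monotone _ hl).trans_eq (Nat.count_nth_of_infinite (p := (· ∈ a)) ha l)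
  have hmaps : ∀ i ∈ s, g i ∈ (Finset.range (f l)).filter (· ∈ a) := by
    intro i hi
    exact Finset.mem_filter.mpr
      ⟨Finset.mem_range.mpr ((hs i hi).2 (hg i hi).1).2, (hg i hi).2⟩
  have hinj : Set.InjOn g s := by
    intro i hi j hj hij
    by_contra hne
    exact Set.disjoint_left.mp (hn.monotone.pairwise_disjoint_on_Ico_succ hne)
      (hg i hi).1 (hij ▸ (hg j hj).1)
  have hle := Finset.card_le_card_of_injOn g hmaps hinj
  rw [← Nat.count_eq_card_filter_range (· ∈ a)] at hle
  omega
end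

section
/- Let a ⊆ ℕ be infinite with strictly increasing enumeration e_a : ℕ → ℕ. Let F be a set of functions ℕ → ℕ satisfying the two closure conditions: (i) for every g ∈ F there is a strictly increasing n ∈ F with n(0) = 0 and n(i+1) > n(i) + g(n(i)) for all i; (ii) for every strictly increasing n ∈ F, the function l ↦ n(2l + 2) + 1 belongs to F. Then the following are equivalent: (1) for every g ∈ F the set {k : g(k) < e_a(k)} is infinite; (2) for every strictly increasing n ∈ F the set {i : [n(i), n(i+1)) ∩ a = ∅} is infinite. -/
theorem le_count_of_forall_Ico_inter_nonempty (p : ℕ → Prop) [DecidablePred p] {n : ℕ → ℕ}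
    (i₀ : ℕ) (h : ∀ i, i₀ ≤ i → ∃ x, n i ≤ x ∧ x < n (i + 1) ∧ p x) (k : ℕ) :
    k ≤ Nat.count p (n (i₀ + k)) := by
  induction k with
  | zero => exact Nat.zero_le _
  | succ k ih =>
    obtain ⟨x, hx₁, hx₂, hx⟩ := h (i₀ + k) (Nat.le_add_right _ _)
    exact (ih.trans (Nat.count_monotone p hx₁)).trans_lt (Nat.count_strict_mono hx hx₂)

/-- Subclaim 2 of Observation 4: for a family `F` of functions `ℕ → ℕ` closed
under the two recursive constructions (i) and (ii), the increasing enumeration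
of an infinite set `a ⊆ ℕ` is undominated over `F` iff every strictly
increasing member of `F` determines infinitely many interval gaps disjoint
from `a`. -/
theorem stmt_3 (a : Set ℕ) (ha : a.Infinite) (F : Set (ℕ → ℕ))
    (hF1 : ∀ g ∈ F, ∃ n ∈ F, StrictMono n ∧ n 0 = 0 ∧
      ∀ i, n (i + 1) > n i + g (n i))
    (hF2 : ∀ n ∈ F, StrictMono n → (fun l => n (2 * l + 2) + 1) ∈ F) :
    (∀ g ∈ F, {k | g k < Nat.nth (· ∈ a) k}.Infinite) ↔
      (∀ n ∈ F, StrictMono n →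
        {i | Set.Ico (n i) (n (i + 1)) ∩ a = ∅}.Infinite) := by
  classical
  constructor
  · intro h n hn hmono hfin
    obtain ⟨b, hb⟩ := hfin.bddAbove
    have hmeet : ∀ i, b + 1 ≤ i → ∃ x, n i ≤ x ∧ x < n (i + 1) ∧ x ∈ a := by
      intro i hi
      have hne : (Set.Ico (n i) (n (i + 1)) ∩ a).Nonempty := by
        rw [Set.nonempty_iff_ne_empty]
        intro he
        have : i ≤ b := hb he
        omega
      obtain ⟨x, hx, hxa⟩ := hne
      exact ⟨x, hx.1, hx.2, hxa⟩
    obtain ⟨k, hk, hbk⟩ := (h _ (hF2 n hn hmono)).exists_gt b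
    have hcount := le_count_of_forall_Ico_inter_nonempty (· ∈ a) (b + 1) hmeet (k + 1)
    have hlt : Nat.nth (· ∈ a) k < n (b + 1 + (k + 1)) := Nat.nth_lt_of_lt_count hcount
    have hle : n (b + 1 + (k + 1)) ≤ n (2 * k + 2) := hmono.monotone (by omega)
    have hk' : n (2 * k + 2) + 1 < Nat.nth (· ∈ a) k := hk
    omega
  · intro h g hg
    obtain ⟨n, hn, hmono, -, hgrow⟩ := hF1 g hg
    refine ((h n hn hmono).image hmono.injective.injOn).mono ?_
    rintro _ ⟨i, hi, rfl⟩
    have hle : n i ≤ Nat.nth (· ∈ a) (n i) := (Nat.nth_strictMono ha).le_apply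
    have hmem : Nat.nth (· ∈ a) (n i) ∈ a := Nat.nth_mem_of_infinite ha _
    show g (n i) < Nat.nth (· ∈ a) (n i)
    by_contra! hlt
    have hi' : Set.Ico (n i) (n (i + 1)) ∩ a = ∅ := hi
    have hin : Nat.nth (· ∈ a) (n i) ∈ Set.Ico (n i) (n (i + 1)) ∩ a :=
      ⟨⟨hle, by have := hgrow i; omega⟩, hmem⟩
    rw [hi'] at hin
    exact hin
end

section
/- Let n ∈ ℕ, let a_0, ..., a_n be infinite subsets of ℕ with union a, and let g : ℕ → ℕ. Suppose that for each l ≤ n the strictly increasing enumeration e_{a_l} satisfies g((n+1)·k) < e_{a_l}(k) for all but finitely many k. Then the strictly increasing enumeration e_a of a satisfies: the set {j : g(j) < e_a(j)} is infinite. -/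
/-- Counting the elements of a set covered by finitely many predicates is subadditive. -/
theorem Nat.count_le_sum_count {ι : Type*} (s : Finset ι) (p : ℕ → Prop) (q : ι → ℕ → Prop)
    [DecidablePred p] [∀ i, DecidablePred (q i)] (hpq : ∀ x, p x → ∃ i ∈ s, q i x) (m : ℕ) :
    Nat.count p m ≤ ∑ i ∈ s, Nat.count (q i) m := by
  classical
  simp only [Nat.count_eq_card_filter_range]
  refine le_trans (Finset.card_le_card fun x hx => ?_) Finset.card_biUnion_le
  obtain ⟨hxm, hxp⟩ := Finset.mem_filter.mp hx
  obtain ⟨i, hi, hix⟩ := hpq x hxp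
  exact Finset.mem_biUnion.mpr ⟨i, hi, Finset.mem_filter.mpr ⟨hxm, hix⟩⟩

/-- If an infinite predicate is covered by finitely many predicates, then for each `k` one of them
has its `k`-th element no later than the `(#s * k)`-th element of the covered predicate. -/
theorem Nat.exists_nth_le_nth_card_mul {ι : Type*} (s : Finset ι) (p : ℕ → Prop)
    (q : ι → ℕ → Prop) (hp : {x | p x}.Infinite) (hpq : ∀ x, p x → ∃ i ∈ s, q i x) (k : ℕ) :
    ∃ i ∈ s, Nat.nth (q i) k ≤ Nat.nth p (s.card * k) := by
  classical
  by_contra! hlt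
  have hcount := Nat.count_le_sum_count s p q hpq (Nat.nth p (s.card * k) + 1)
  rw [Nat.count_nth_succ_of_infinite hp] at hcount
  have hsum : ∑ i ∈ s, Nat.count (q i) (Nat.nth p (s.card * k) + 1) ≤ s.card * k := by
    refine Finset.sum_le_card_nsmul s _ k fun i hi => ?_
    by_contra! hk
    exact (Nat.lt_succ_iff.mp (Nat.nth_lt_of_lt_count hk)).not_gt (hlt i hi)
  omega

/-- From Claim 8: if each `a l` (`l ≤ n`) has enumeration eventually dominating
`k ↦ g ((n+1)·k)`, then the enumeration of the union is not dominated by `g`. -/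
theorem stmt_5 (n : ℕ) (a : ℕ → Set ℕ) (hInf : ∀ l ≤ n, (a l).Infinite)
    (A : Set ℕ) (hA : A = {x | ∃ l ≤ n, x ∈ a l}) (g : ℕ → ℕ)
    (h : ∀ l ≤ n, ∀ᶠ k in Filter.atTop, g ((n + 1) * k) < Nat.nth (· ∈ a l) k) :
    {j | g j < Nat.nth (· ∈ A) j}.Infinite := by
  have hAinf : A.Infinite :=
    (hInf 0 n.zero_le).mono fun x hx => hA ▸ ⟨0, n.zero_le, hx⟩
  have hev : ∀ᶠ k in Filter.atTop, ∀ l ∈ Finset.range (n + 1),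
      g ((n + 1) * k) < Nat.nth (· ∈ a l) k :=
    (Filter.eventually_all_finset _).mpr fun l hl => h l (Finset.mem_range_succ_iff.mp hl)
  refine Set.infinite_of_forall_exists_gt fun N => ?_
  obtain ⟨k, hk, hNk⟩ := (hev.and (Filter.eventually_gt_atTop N)).exists
  obtain ⟨l, hl, hle⟩ := Nat.exists_nth_le_nth_card_mul (Finset.range (n + 1)) (· ∈ A)
    (fun l => (· ∈ a l)) hAinf (fun x hx => by simpa [hA, Nat.lt_succ_iff] using hx) k
  rw [Finset.card_range] at hle
  exact ⟨(n + 1) * k, (hk l hl).trans_le hle,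
    hNk.trans_le (Nat.le_mul_of_pos_left k n.succ_pos)⟩
end

section
/- Let n ∈ ℕ, let a_0, ..., a_n be infinite subsets of ℕ with union a, let (m_i)_{i<ω} be a strictly increasing sequence of natural numbers, and let (i(k))_{k<ω} be a sequence of natural numbers satisfying i(k+1) > i(k) + (n+1)·k for all k. Suppose that for each l ≤ n the strictly increasing enumeration e_{a_l} satisfies m_{i(k+1)} < e_{a_l}(k) for all but finitely many k. Then the set {i : a ∩ [m_i, m_{i+1}) = ∅} is infinite; in fact, for all sufficiently large k there exists i with i(k) ≤ i < i(k+1) and a ∩ [m_i, m_{i+1}) = ∅. -/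
/-- If `n + 1` infinite sets each have their `k`-th element (counting from `0`) beyond `m q`, then
among more than `(n + 1) * k` consecutive intervals `[m j, m (j + 1))` with `p ≤ j < q`, at least
one is disjoint from all the sets. -/
theorem exists_Ico_disjoint_of_lt_nth {n k p q : ℕ} {a : ℕ → Set ℕ} {m : ℕ → ℕ}
    (ha : ∀ l ≤ n, (a l).Infinite) (hm : StrictMono m) (hpq : p + (n + 1) * k < q)
    (hk : ∀ l ≤ n, m q < Nat.nth (· ∈ a l) k) :
    ∃ j, p ≤ j ∧ j < q ∧ {x | ∃ l ≤ n, x ∈ a l} ∩ Set.Ico (m j) (m (j + 1)) = ∅ := by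
  by_contra! hne
  have hex : ∀ j ∈ Finset.Ico p q, ∃ c ∈ Finset.range (n + 1) ×ˢ Finset.range k,
      Nat.nth (· ∈ a c.1) c.2 ∈ Set.Ico (m j) (m (j + 1)) := by
    intro j hj
    rw [Finset.mem_Ico] at hj
    obtain ⟨x, ⟨l, hl, hx⟩, hxj⟩ := hne j hj.1 hj.2
    obtain ⟨c, rfl⟩ : x ∈ Set.range (Nat.nth (· ∈ a l)) :=
      (Nat.range_nth_of_infinite (p := (· ∈ a l)) (ha l hl)).symm.subset hx
    have hck : c < k := (Nat.nth_lt_nth (ha l hl)).1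
      ((hxj.2.trans_le (hm.monotone hj.2)).trans (hk l hl))
    exact ⟨(l, c), by simp only [Finset.mem_product, Finset.mem_range]; omega, hxj⟩
  choose! f hf hfm using hex
  have hcard := Finset.card_le_card_of_injOn f hf (by
    intro j hj j' hj' hjj
    have h := hfm j hj
    have h' := hfm j' hj'
    rw [← hjj] at h'
    have h₁ := hm.lt_iff_lt.1 (h.1.trans_lt h'.2)
    have h₂ := hm.lt_iff_lt.1 (h'.1.trans_lt h.2)
    omega)
  rw [Finset.card_product, Finset.card_range, Finset.card_range, Nat.card_Ico] at hcard
  omega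


/-- Main combinatorial step of Claim 8: if the enumeration of each `a l`
(`l ≤ n`) eventually dominates `k ↦ m (i (k+1))`, where `i` satisfies
`i (k+1) > i k + (n+1)·k`, then the union `A` avoids infinitely many of the
intervals `[m j, m (j+1))`; in fact for all sufficiently large `k` some such
interval with `i k ≤ j < i (k+1)` is disjoint from `A`. -/
theorem stmt_7 (n : ℕ) (a : ℕ → Set ℕ) (hInf : ∀ l ≤ n, (a l).Infinite)
    (A : Set ℕ) (hA : A = {x | ∃ l ≤ n, x ∈ a l})
    (m : ℕ → ℕ) (hm : StrictMono m)
    (i : ℕ → ℕ) (hi : ∀ k, i (k + 1) > i k + (n + 1) * k)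
    (hdom : ∀ l ≤ n, ∀ᶠ k in Filter.atTop, m (i (k + 1)) < Nat.nth (· ∈ a l) k) :
    {j | A ∩ Set.Ico (m j) (m (j + 1)) = ∅}.Infinite ∧
      ∀ᶠ k in Filter.atTop, ∃ j, i k ≤ j ∧ j < i (k + 1) ∧
        A ∩ Set.Ico (m j) (m (j + 1)) = ∅ := by
  subst hA
  have hev : ∀ᶠ k in Filter.atTop, ∃ j, i k ≤ j ∧ j < i (k + 1) ∧
      {x | ∃ l ≤ n, x ∈ a l} ∩ Set.Ico (m j) (m (j + 1)) = ∅ := by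
    have hall : ∀ᶠ k in Filter.atTop, ∀ l ∈ Set.Iic n,
        m (i (k + 1)) < Nat.nth (· ∈ a l) k :=
      (Filter.eventually_all_finite (Set.finite_Iic n)).2 hdom
    filter_upwards [hall] with k hk
    exact exists_Ico_disjoint_of_lt_nth hInf hm (hi k) hk
  refine ⟨?_, hev⟩
  have hmono : StrictMono i := strictMono_nat_of_lt_succ fun k => by
    have := hi k
    omega
  rw [Set.infinite_iff_exists_gt]
  intro N
  obtain ⟨k, ⟨j, hkj, -, hj⟩, hNk⟩ := (hev.and (Filter.eventually_gt_atTop N)).exists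
  exact ⟨j, hj, (hNk.trans_le (hmono.le_apply)).trans_le hkj⟩
end

section
/- Let F be a countable set of functions ℕ → ℕ and let A be an almost disjoint family of infinite subsets of ℕ. Then there exists a collection B of infinite subsets of ℕ such that: (1) for every τ ∈ B and every g ∈ F, the strictly increasing enumeration e_τ of τ satisfies g(k) < e_τ(k) for all but finitely many k; and (2) A ∪ B is a maximal almost disjoint family. -/
/-- Any countable family of functions `ℕ → ℕ` is eventually strictly dominated by one function. -/
theorem Set.Countable.exists_eventually_lt {F : Set (ℕ → ℕ)} (hF : F.Countable) :
    ∃ h : ℕ → ℕ, ∀ g ∈ F, ∀ᶠ k in Filter.atTop, g k < h k := by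
  obtain ⟨f, hf⟩ := Set.countable_iff_exists_subset_range.mp hF
  refine ⟨fun k => (Finset.range (k + 1)).sup (fun i => f i k) + 1, fun g hg => ?_⟩
  obtain ⟨i, rfl⟩ := hf hg
  filter_upwards [Filter.eventually_ge_atTop i] with k hk
  exact Nat.lt_succ_of_le
    (Finset.le_sup (f := fun i => f i k) (Finset.mem_range.mpr (Nat.lt_succ_of_le hk)))

/-- Every infinite set of naturals has an infinite subset whose increasing enumeration lies
strictly above a given function. -/
theorem Set.Infinite.exists_subset_lt_nth {x : Set ℕ} (hx : x.Infinite) (h : ℕ → ℕ) :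
    ∃ τ ⊆ x, τ.Infinite ∧ ∀ k, h k < Nat.nth (· ∈ τ) k := by
  obtain ⟨φ, hφ, hφx⟩ := Filter.extraction_forall_of_frequently
    (P := fun n k => k ∈ x ∧ h n < k) fun n =>
      (Nat.frequently_atTop_iff_infinite.mpr hx).and_eventually (Filter.eventually_gt_atTop (h n))
  have hinf : (Set.range φ).Infinite := Set.infinite_range_of_injective hφ.injective
  have hnth : Nat.nth (· ∈ Set.range φ) = φ :=
    ((Nat.nth_strictMono hinf).range_inj hφ).mp (Nat.range_nth_of_infinite hinf)
  refine ⟨Set.range φ, Set.range_subset_iff.mpr fun n => (hφx n).1, hinf, fun k => ?_⟩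
  rw [hnth]
  exact (hφx k).2

/-- If every infinite set of naturals contains an infinite member of `P`, then any almost disjoint
family can be completed to a maximal one by adding infinite members of `P`. -/
theorem exists_maximal_almostDisjoint_union {P : Set (Set ℕ)}
    (hP : ∀ x : Set ℕ, x.Infinite → ∃ τ ⊆ x, τ.Infinite ∧ τ ∈ P)
    {A : Set (Set ℕ)} (hA : A.Pairwise fun x y => (x ∩ y).Finite) :
    ∃ B : Set (Set ℕ), (∀ τ ∈ B, τ.Infinite ∧ τ ∈ P) ∧
      (A ∪ B).Pairwise (fun x y => (x ∩ y).Finite) ∧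
      ∀ x : Set ℕ, x.Infinite → ∃ y ∈ A ∪ B, (x ∩ y).Infinite := by
  obtain ⟨B, hB⟩ := zorn_subset
    {B : Set (Set ℕ) | (∀ τ ∈ B, τ.Infinite ∧ τ ∈ P) ∧
      (A ∪ B).Pairwise fun x y => (x ∩ y).Finite} (by
    intro c hc hchain
    rcases c.eq_empty_or_nonempty with rfl | hne
    · exact ⟨∅, ⟨by simp, by simpa using hA⟩, by simp⟩
    refine ⟨⋃₀ c, ⟨?_, ?_⟩, fun s hs => Set.subset_sUnion_of_mem hs⟩
    · rintro τ ⟨s, hs, hτ⟩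
      exact (hc hs).1 τ hτ
    · have hU : A ∪ ⋃₀ c = ⋃₀ ((A ∪ ·) '' c) := by
        rw [Set.sUnion_image, Set.sUnion_eq_biUnion]
        simp only [Set.iUnion_union_distrib, Set.biUnion_const hne]
      rw [hU, Set.pairwise_sUnion]
      · rintro _ ⟨s, hs, rfl⟩
        exact (hc hs).2
      · rintro _ ⟨s, hs, rfl⟩ _ ⟨t, ht, rfl⟩
        rcases hchain.total hs ht with hst | hts
        · exact ⟨A ∪ t, ⟨t, ht, rfl⟩, Set.union_subset_union_right A hst, subset_rfl⟩
        · exact ⟨A ∪ s, ⟨s, hs, rfl⟩, subset_rfl, Set.union_subset_union_right A hts⟩)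
  refine ⟨B, hB.prop.1, hB.prop.2, fun x hx => ?_⟩
  by_contra! hfin
  obtain ⟨τ, hτx, hτinf, hτP⟩ := hP x hx
  have hτfin : ∀ y ∈ A ∪ B, (τ ∩ y).Finite := fun y hy =>
    (hfin y hy).subset (Set.inter_subset_inter_left y hτx)
  have hmem : τ ∈ B := by
    refine hB.le_of_ge ⟨?_, ?_⟩ (Set.subset_insert τ B) (Set.mem_insert τ B)
    · rintro σ (rfl | hσ)
      exacts [⟨hτinf, hτP⟩, hB.prop.1 σ hσ]
    · rw [Set.union_insert]
      exact hB.prop.2.insert fun y hy _ => ⟨hτfin y hy, Set.inter_comm τ y ▸ hτfin y hy⟩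
  exact hτinf (Set.inter_self τ ▸ hτfin τ (Or.inr hmem))


/-- Claim 8 combined: any almost disjoint family `A` can be completed to a
maximal almost disjoint family `A ∪ B` using only infinite sets whose
increasing enumerations eventually dominate every member of a prescribed
countable family `F` of functions. -/
theorem stmt_10 (F : Set (ℕ → ℕ)) (hF : F.Countable)
    (A : Set (Set ℕ)) (hAinf : ∀ x ∈ A, x.Infinite)
    (hAad : ∀ x ∈ A, ∀ y ∈ A, x ≠ y → (x ∩ y).Finite) :
    ∃ B : Set (Set ℕ),
      (∀ τ ∈ B, τ.Infinite) ∧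
      (∀ τ ∈ B, ∀ g ∈ F, ∀ᶠ k in Filter.atTop, g k < Nat.nth (· ∈ τ) k) ∧
      (∀ x ∈ A ∪ B, ∀ y ∈ A ∪ B, x ≠ y → (x ∩ y).Finite) ∧
      (∀ x : Set ℕ, x.Infinite → ∃ y ∈ A ∪ B, (x ∩ y).Infinite) := by
  obtain ⟨h, hh⟩ := hF.exists_eventually_lt
  obtain ⟨B, hB, hpair, hmax⟩ := exists_maximal_almostDisjoint_union
    (P := {τ | ∀ k, h k < Nat.nth (· ∈ τ) k}) (fun x hx => hx.exists_subset_lt_nth h)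
    (A := A) fun x hx y hy => hAad x hx y hy
  exact ⟨B, fun τ hτ => (hB τ hτ).1,
    fun τ hτ g hg => (hh g hg).mono fun k hk => hk.trans ((hB τ hτ).2 k),
    fun x hx y hy => hpair hx hy, hmax⟩
end
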